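/- (Theorem 1 of the paper, deterministic core.) Suppose an attacker clones a user's hardware security key, so that after cloning both the original key and the cloned key store the same challenge hash c : α. Consider any protocol trace starting from the empty window whose send values are pairwise distinct, containing two respond c operations (one issued from the cloned key by the attacker and one issued from the original key by the user, in either order). Then it is impossible that both respond c operations succeed: either the user's authentication fails (the relying party detects the clone attack) or the attacker's authentication fails (the attacker cannot authenticate as the user). -/

import Mathlib

/-- Remove items from the head of `l` up to and including the first occurrence
of `c`; if `c ∉ l`, the result is `[]`. -/
def removeThrough {α : Type*} [DecidableEq α] (c : α) (l : List α) : List α :=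
  (l.dropWhile (fun x => decide (x ≠ c))).tail

/-- An operation in a protocol trace: the relying party sends a challenge hash,
or an authenticator responds with a stored challenge hash. -/
inductive Op (α : Type*) where
  | send (c : α)
  | respond (c : α)

/-- One step of the relying party's window update. A `send c` appends `c` to the
window; a `respond c` succeeds iff `c` is in the window, in which case the window
is updated to `removeThrough c`; a failed respond leaves the window unchanged. -/
def step {α : Type*} [DecidableEq α] (w : List α) (o : Op α) : List α :=
  match o with
  | .send c => w ++ [c]
  | .respond c => if c ∈ w then removeThrough c w else w

/-- The window after processing a whole trace from initial window `init`. -/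
def window {α : Type*} [DecidableEq α] (init : List α) (t : List (Op α)) : List α :=
  t.foldl step init

/-- The list of values of the `send` operations of a trace, in order. -/
def sends {α : Type*} : List (Op α) → List α :=
  List.filterMap (fun o => match o with | .send c => some c | .respond _ => none)

theorem removeThrough_sublist {α : Type*} [DecidableEq α] (c : α) (l : List α) :
    (removeThrough c l).Sublist l :=
  (List.tail_sublist _).trans (List.dropWhile_sublist _)

theorem notMem_removeThrough {α : Type*} [DecidableEq α] (c : α) {l : List α}
    (h : l.Nodup) : c ∉ removeThrough c l := by
  induction l with
  | nil => simp [removeThrough]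
  | cons a l ih =>
    rw [List.nodup_cons] at h
    by_cases hac : a = c
    · subst hac
      simpa [removeThrough] using h.1
    · simpa [removeThrough, hac] using ih h.2

theorem window_append {α : Type*} [DecidableEq α] (w : List α) (s t : List (Op α)) :
    window w (s ++ t) = window (window w s) t :=
  List.foldl_append

theorem sends_append {α : Type*} (s t : List (Op α)) :
    sends (s ++ t) = sends s ++ sends t :=
  List.filterMap_append

/-- The window only ever holds challenges that were there initially or were sent since,
in their original order. -/
theorem window_sublist {α : Type*} [DecidableEq α] (w : List α) (t : List (Op α)) :
    (window w t).Sublist (w ++ sends t) := by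
  induction t generalizing w with
  | nil => simp [window, sends]
  | cons o t ih =>
    refine (ih (step w o)).trans ?_
    cases o with
    | send c => simp [step, sends]
    | respond c =>
      have hstep : (step w (Op.respond c)).Sublist w := by
        unfold step
        dsimp only
        split_ifs
        · exact removeThrough_sublist c w
        · exact List.Sublist.refl w
      exact hstep.append (List.Sublist.refl _)

/-- After a successful `respond c`, the challenge `c` never reappears in the window. -/
theorem notMem_window_of_respond {α : Type*} [DecidableEq α] {c : α} {s t : List (Op α)}
    (hnd : (sends (s ++ Op.respond c :: t)).Nodup) (hc : c ∈ window [] s) :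
    c ∉ window [] (s ++ Op.respond c :: t) := by
  have hsub : (window [] s).Sublist (sends s) := window_sublist [] s
  rw [sends_append] at hnd
  have hsplit : (sends s ++ sends t).Nodup := hnd
  have hwin : window [] (s ++ Op.respond c :: t) =
      window (removeThrough c (window [] s)) t := by
    rw [window_append]
    simp only [window, List.foldl_cons, step]
    exact congrArg (fun w => List.foldl step w t) (if_pos hc)
  rw [hwin]
  intro hmem
  rcases List.mem_append.1 ((window_sublist _ t).subset hmem) with h | h
  · exact notMem_removeThrough c ((List.nodup_append.1 hsplit).1.sublist hsub) h
  · exact (List.nodup_append.1 hsplit).2.2 c (hsub.subset hc) c h rfl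

theorem notMem_window_take_of_lt {α : Type*} [DecidableEq α] {t : List (Op α)}
    (hnd : (sends t).Nodup) {c : α} {i j : ℕ} (hij : i < j)
    (hi : t[i]? = some (Op.respond c)) (hc : c ∈ window [] (t.take i)) :
    c ∉ window [] (t.take j) := by
  obtain ⟨hlt, hget⟩ := List.getElem?_eq_some_iff.1 hi
  have htake : t.take j = t.take i ++ Op.respond c :: (t.drop (i + 1)).take (j - (i + 1)) := by
    obtain ⟨k, rfl⟩ := Nat.exists_eq_add_of_lt hij
    rw [add_assoc, List.take_add, List.drop_eq_getElem_cons hlt, hget, List.take_succ_cons]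
    congr 3
    omega
  have hndj : (sends (t.take j)).Nodup :=
    hnd.sublist ((List.take_sublist j t).filterMap _)
  rw [htake] at hndj ⊢
  exact notMem_window_of_respond hndj hc

/-- Theorem 1 of the paper (deterministic core): if both the original and the
cloned key store the same challenge hash `c`, then in any trace with pairwise
distinct send values containing two `respond c` operations (attacker's and
user's, at distinct positions `i ≠ j`), it is impossible that both succeed. -/
theorem stmt_4 {α : Type*} [DecidableEq α] (t : List (Op α))
    (hnd : (sends t).Nodup) (c : α) (i j : ℕ) (hij : i ≠ j)
    (hi : t[i]? = some (Op.respond c)) (hj : t[j]? = some (Op.respond c)) :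
    ¬(c ∈ window [] (t.take i) ∧ c ∈ window [] (t.take j)) := by
  rintro ⟨hci, hcj⟩
  rcases Nat.lt_or_gt_of_ne hij with h | h
  · exact notMem_window_take_of_lt hnd h hi hci hcj
  · exact notMem_window_take_of_lt hnd h hj hcj hci
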